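/- arXiv:2601.14151 — 3 statements merged into one kernel-verified Lean document; each statement's English description precedes it below -/
import Mathlib

section
/- Let f, g : ℕ → ℕ be increasing functions such that at least one of f, g has controlled growth and lim_{n→∞} f(n)/g(n) = 1. Then the sets of achievable burning densities coincide: P(G(f)) = P(G(g)). -/
open Filter Asymptotics

/-- Membership in the grid `[-f n, f n]^2 ⊆ ℤ × ℤ`. -/
def inGrid (f : ℕ → ℕ) (n : ℕ) (p : ℤ × ℤ) : Prop :=
  |p.1| ≤ (f n : ℤ) ∧ |p.2| ≤ (f n : ℤ)

instance (f : ℕ → ℕ) (n : ℕ) : DecidablePred (inGrid f n) := fun _ => by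
  unfold inGrid; infer_instance

/-- The four lattice neighbours (at `L¹`-distance one) of a point. -/
def nbrs (p : ℤ × ℤ) : Finset (ℤ × ℤ) :=
  {(p.1 + 1, p.2), (p.1 - 1, p.2), (p.1, p.2 + 1), (p.1, p.2 - 1)}

/-- An activator sequence: whenever `V n ≠ ∅` (for `n ≥ 1`), the activated vertex
lies in the grid at time `n`. -/
def IsActivator (f : ℕ → ℕ) (V : ℕ → Option (ℤ × ℤ)) : Prop :=
  ∀ n, 1 ≤ n → ∀ p, V n = some p → inGrid f n p

/-- The burning process: `B 0 = ∅`, and `B n` is obtained from `B (n-1)` by adding all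
vertices of the grid at time `n` adjacent to a vertex of `B (n-1)`, and then adding
the activator `V n` if it is not `∅`. -/
def burnSet (f : ℕ → ℕ) (V : ℕ → Option (ℤ × ℤ)) : ℕ → Finset (ℤ × ℤ)
  | 0 => ∅
  | n + 1 =>
    let B := burnSet f V n
    let spread := B ∪ (B.biUnion nbrs).filter (inGrid f (n + 1))
    match V (n + 1) with
    | none => spread
    | some v => insert v spread

/-- The proportion `|B n| / |V(G n)|` of burning vertices at time `n`. -/
noncomputable def densitySeq (f : ℕ → ℕ) (V : ℕ → Option (ℤ × ℤ)) (n : ℕ) : ℝ :=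
  ((burnSet f V n).card : ℝ) / (2 * (f n : ℝ) + 1) ^ 2

/-- The lower burning density `δ̲(G(f), V)`. -/
noncomputable def lowerDensity (f : ℕ → ℕ) (V : ℕ → Option (ℤ × ℤ)) : ℝ :=
  liminf (densitySeq f V) atTop

/-- The upper burning density `δ̄(G(f), V)`. -/
noncomputable def upperDensity (f : ℕ → ℕ) (V : ℕ → Option (ℤ × ℤ)) : ℝ :=
  limsup (densitySeq f V) atTop

/-- The burning density of `V` in `G(f)` exists and equals `ρ`. -/
def HasBurningDensity (f : ℕ → ℕ) (V : ℕ → Option (ℤ × ℤ)) (ρ : ℝ) : Prop :=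
  Tendsto (densitySeq f V) atTop (nhds ρ)

/-- `P(G(f))`: the set of `ρ ∈ [0,1]` achievable as the burning density of some
non-empty activator sequence. -/
def densSet (f : ℕ → ℕ) : Set ℝ :=
  {ρ | ρ ∈ Set.Icc (0 : ℝ) 1 ∧
    ∃ V : ℕ → Option (ℤ × ℤ), IsActivator f V ∧ (∃ t, 1 ≤ t ∧ V t ≠ none) ∧
      HasBurningDensity f V ρ}

/-- The controlled growth requirement. -/
def ControlledGrowth (f : ℕ → ℕ) : Prop :=
  (∀ᶠ n in atTop, f n < f (n + 1)) ∧
  (∀ ε : ℕ → ℕ, (fun n => (ε n : ℝ)) =o[atTop] (fun n => (n : ℝ)) →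
    Tendsto (fun n => (f (n + ε n) : ℝ) / (f n : ℝ)) atTop (nhds 1)) ∧
  (∀ c : ℝ, 0 < c → ∃ d : ℝ, 0 < d ∧
    ∀ᶠ n in atTop, (1 + d) * (f n : ℝ) ≤ (f (n + ⌈c * n⌉₊) : ℝ))

lemma mem_burnSet_succ {f : ℕ → ℕ} {V : ℕ → Option (ℤ × ℤ)} {n : ℕ} {p : ℤ × ℤ} :
    p ∈ burnSet f V (n + 1) ↔ p ∈ burnSet f V n ∨
      ((∃ q ∈ burnSet f V n, p ∈ nbrs q) ∧ inGrid f (n + 1) p) ∨ V (n + 1) = some p := by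
  rw [burnSet]
  cases h : V (n + 1) with
  | none => simp
  | some v =>
    simp only [Finset.mem_insert, Finset.mem_union, Finset.mem_filter, Finset.mem_biUnion,
      Option.some.injEq, eq_comm (a := v)]
    rw [or_comm, or_assoc]

lemma burnSet_mono (f : ℕ → ℕ) (V : ℕ → Option (ℤ × ℤ)) : Monotone (burnSet f V) :=
  monotone_nat_of_le_succ fun _ _ hp => mem_burnSet_succ.2 (Or.inl hp)

lemma inGrid.of_le {f g : ℕ → ℕ} {m n : ℕ} {p : ℤ × ℤ} (h : inGrid f m p) (hfg : f m ≤ g n) :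
    inGrid g n p :=
  have hfg' : (f m : ℤ) ≤ g n := by exact_mod_cast hfg
  ⟨h.1.trans hfg', h.2.trans hfg'⟩

/-- If every activation of `V` is repeated by `W` along the time change `s`, and the grids of `g`
at the changed times contain those of `f`, then the burning set of `g` dominates. -/
lemma burnSet_subset_burnSet_comp {f g s : ℕ → ℕ} {V W : ℕ → Option (ℤ × ℤ)}
    (hs : StrictMono s) (hfg : ∀ n, f n ≤ g (s n))
    (hVW : ∀ n p, V (n + 1) = some p → p ∈ burnSet g W (s (n + 1))) (n : ℕ) :
    burnSet f V n ⊆ burnSet g W (s n) := by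
  induction n with
  | zero => simp [burnSet]
  | succ n ih =>
    intro p hp
    have hlt : s n < s (n + 1) := hs n.lt_succ_self
    obtain hp | ⟨⟨q, hq, hpq⟩, hp⟩ | hp := mem_burnSet_succ.1 hp
    · exact burnSet_mono g W hlt.le (ih hp)
    · have hgrid := hp.of_le (hfg (n + 1))
      obtain ⟨m, hm⟩ : ∃ m, s (n + 1) = m + 1 := ⟨s (n + 1) - 1, by lia⟩
      rw [hm] at hgrid ⊢
      exact mem_burnSet_succ.2
        (Or.inr (Or.inl ⟨⟨q, burnSet_mono g W (by lia) (ih hq), hpq⟩, hgrid⟩))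
    · exact hVW n p hp

/-- The activator sequence that performs the activations of `V` at the times given by `s`. -/
noncomputable def delayedActivator (s : ℕ → ℕ) (V : ℕ → Option (ℤ × ℤ)) : ℕ → Option (ℤ × ℤ) :=
  Function.extend (fun k => s (k + 1)) (fun k => V (k + 1)) fun _ => none

lemma delayedActivator_apply {s : ℕ → ℕ} (hs : StrictMono s) (V : ℕ → Option (ℤ × ℤ)) (k : ℕ) :
    delayedActivator s V (s (k + 1)) = V (k + 1) :=
  Function.Injective.extend_apply (fun a b h => by simpa using hs.injective h) _ _ k

lemma exists_of_delayedActivator_eq_some {s : ℕ → ℕ} (hs : StrictMono s)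
    {V : ℕ → Option (ℤ × ℤ)} {n : ℕ} {p : ℤ × ℤ} (h : delayedActivator s V n = some p) :
    ∃ k, s (k + 1) = n ∧ V (k + 1) = some p := by
  by_cases hn : ∃ k, s (k + 1) = n
  · obtain ⟨k, rfl⟩ := hn
    exact ⟨k, rfl, by rwa [delayedActivator_apply hs] at h⟩
  · rw [delayedActivator, Function.extend_apply' _ _ _ hn] at h
    cases h

lemma mem_burnSet_of_activated {f : ℕ → ℕ} {V : ℕ → Option (ℤ × ℤ)} {k n : ℕ} {p : ℤ × ℤ}
    (h : V (k + 1) = some p) (hkn : k + 1 ≤ n) : p ∈ burnSet f V n :=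
  burnSet_mono f V hkn (mem_burnSet_succ.2 (Or.inr (Or.inr h)))

lemma tendsto_grid_card_ratio {a b : ℕ → ℕ}
    (h : Tendsto (fun n => (a n : ℝ) / b n) atTop (nhds 1)) :
    Tendsto (fun n => (2 * (a n : ℝ) + 1) ^ 2 / (2 * (b n : ℝ) + 1) ^ 2) atTop (nhds 1) := by
  have hb : ∀ᶠ n in atTop, (b n : ℝ) ≠ 0 := by
    filter_upwards [h.eventually_ne one_ne_zero] with n hn hb
    exact hn (by rw [hb, div_zero])
  have hratio : Tendsto (fun n => (2 * (a n : ℝ) + 1) / (2 * (b n : ℝ) + 1)) atTop (nhds 1) := by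
    rw [tendsto_iff_norm_sub_tendsto_zero] at h ⊢
    refine squeeze_zero' (.of_forall fun _ => norm_nonneg _) ?_ h
    filter_upwards [hb] with n hn
    have hpos : (0 : ℝ) < b n := lt_of_le_of_ne (Nat.cast_nonneg _) hn.symm
    rw [div_sub_one hn, div_sub_one (by positivity), norm_div, norm_div,
      Real.norm_of_nonneg hpos.le,
      Real.norm_of_nonneg (show (0 : ℝ) ≤ 2 * b n + 1 by positivity),
      show 2 * (a n : ℝ) + 1 - (2 * (b n : ℝ) + 1) = 2 * (a n - b n) by ring, norm_mul,
      Real.norm_of_nonneg zero_le_two, div_le_div_iff₀ (by positivity) hpos]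
    nlinarith [norm_nonneg ((a n : ℝ) - b n)]
  simpa [div_pow] using hratio.pow 2

lemma densitySeq_le_mul {f g : ℕ → ℕ} {V W : ℕ → Option (ℤ × ℤ)} {m n : ℕ}
    (h : burnSet f V m ⊆ burnSet g W n) :
    densitySeq f V m * ((2 * (f m : ℝ) + 1) ^ 2 / (2 * (g n : ℝ) + 1) ^ 2) ≤ densitySeq g W n := by
  have hcard : ((burnSet f V m).card : ℝ) ≤ (burnSet g W n).card := by
    exact_mod_cast Finset.card_le_card h
  rw [densitySeq, densitySeq, div_mul_div_cancel₀ (by positivity)]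
  gcongr

lemma eventually_le_mul_of_tendsto_div {f g : ℕ → ℕ}
    (h : Tendsto (fun n => (f n : ℝ) / g n) atTop (nhds 1)) {d : ℝ} (hd : 0 < d) :
    ∀ᶠ n in atTop, (f n : ℝ) ≤ (1 + d) * g n := by
  filter_upwards [h.eventually_lt_const (show 1 < 1 + d by linarith),
    h.eventually_ne one_ne_zero] with n hn hne
  have hg : (g n : ℝ) ≠ 0 := fun hg => hne (by rw [hg, div_zero])
  exact ((div_lt_iff₀ (lt_of_le_of_ne (Nat.cast_nonneg _) hg.symm)).1 hn).le

lemma tendsto_div_swap {f g : ℕ → ℕ} (h : Tendsto (fun n => (f n : ℝ) / g n) atTop (nhds 1)) :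
    Tendsto (fun n => (g n : ℝ) / f n) atTop (nhds 1) := by
  simpa using h.inv₀ one_ne_zero

/-- The slow variation property: a sublinear time shift does not change `f` asymptotically. -/
def StableUnderSublinearShift (f : ℕ → ℕ) : Prop :=
  ∀ ε : ℕ → ℕ, (fun n => (ε n : ℝ)) =o[atTop] (fun n => (n : ℝ)) →
    Tendsto (fun n => (f (n + ε n) : ℝ) / (f n : ℝ)) atTop (nhds 1)

lemma StableUnderSublinearShift.congr {f g : ℕ → ℕ} (hf : StableUnderSublinearShift f)
    (h : Tendsto (fun n => (f n : ℝ) / g n) atTop (nhds 1)) : StableUnderSublinearShift g := by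
  intro ε hε
  have hshift : Tendsto (fun n => n + ε n) atTop atTop :=
    tendsto_atTop_mono (fun n => Nat.le_add_right n _) tendsto_id
  have h' := tendsto_div_swap h
  have key := ((h'.comp hshift).mul (hf ε hε)).mul h
  simp only [mul_one] at key
  refine key.congr' ?_
  filter_upwards [h.eventually_ne one_ne_zero, hshift.eventually (h.eventually_ne one_ne_zero)]
    with n hn hn'
  have h1 : (f n : ℝ) ≠ 0 := fun h0 => hn (by rw [h0, zero_div])
  have h2 : (f (n + ε n) : ℝ) ≠ 0 := fun h0 => hn' (by rw [h0, zero_div])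
  simp only [Function.comp_apply]
  field_simp

/-- A nondecreasing sublinear delay after which each of the two grids contains the other. -/
lemma exists_sublinear_delay {f g : ℕ → ℕ} (hf : Monotone f) (hg : Monotone g)
    (hcg : ControlledGrowth f) (h : Tendsto (fun n => (f n : ℝ) / g n) atTop (nhds 1)) :
    ∃ ε : ℕ → ℕ, Monotone ε ∧ (∀ n, f n ≤ g (n + ε n)) ∧ (∀ n, g n ≤ f (n + ε n)) ∧
      (fun n => (ε n : ℝ)) =o[atTop] (fun n => (n : ℝ)) := by
  have hftop : Tendsto f atTop atTop := by
    obtain ⟨N, hN⟩ := eventually_atTop.1 hcg.1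
    have : StrictMono fun n => f (n + N) := strictMono_nat_of_lt_succ fun n => by
      simpa [Nat.add_right_comm] using hN (n + N) (by lia)
    exact (tendsto_add_atTop_iff_nat N).1 this.tendsto_atTop
  have hgtop : Tendsto g atTop atTop := by
    rw [tendsto_atTop]
    intro b
    filter_upwards [hftop.eventually_ge_atTop (2 * b),
      eventually_le_mul_of_tendsto_div h one_pos] with n hn hn'
    have : f n ≤ 2 * g n := by
      have : (f n : ℝ) ≤ 2 * g n := by linarith
      exact_mod_cast this
    lia
  have hex : ∀ n, ∃ e, f n ≤ g (n + e) ∧ g n ≤ f (n + e) := by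
    intro n
    obtain ⟨m, hm, hm1, hm2⟩ := ((eventually_ge_atTop n).and
      ((hgtop.eventually_ge_atTop (f n)).and (hftop.eventually_ge_atTop (g n)))).exists
    exact ⟨m - n, by rwa [Nat.add_sub_cancel' hm], by rwa [Nat.add_sub_cancel' hm]⟩
  classical
  let e : ℕ → ℕ := fun n => Nat.find (hex n)
  have hle : ∀ n, e n ≤ (Finset.range (n + 1)).sup e := fun n =>
    Finset.le_sup (f := e) (Finset.self_mem_range_succ n)
  refine ⟨fun n => (Finset.range (n + 1)).sup e,
    fun m n hmn => Finset.sup_mono (Finset.range_mono (by lia)),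
    fun n => (Nat.find_spec (hex n)).1.trans (hg (Nat.add_le_add_left (hle n) n)),
    fun n => (Nat.find_spec (hex n)).2.trans (hf (Nat.add_le_add_left (hle n) n)), ?_⟩
  rw [isLittleO_iff]
  intro c hc
  obtain ⟨d, hd, hgrow⟩ := hcg.2.2 (c / 2) (by positivity)
  have hevent : ∀ᶠ n in atTop, (e n : ℝ) ≤ c / 2 * n + 1 := by
    have hfg := eventually_le_mul_of_tendsto_div h hd
    have hgf := eventually_le_mul_of_tendsto_div (tendsto_div_swap h) hd
    have hshift : Tendsto (fun n : ℕ => n + ⌈c / 2 * n⌉₊) atTop atTop :=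
      tendsto_atTop_mono (fun n => Nat.le_add_right n _) tendsto_id
    filter_upwards [hgrow, hshift.eventually hfg, hgf] with n h1 h2 h3
    have hfind : e n ≤ ⌈c / 2 * n⌉₊ := by
      refine Nat.find_min' (hex n) ⟨?_, ?_⟩
      · have : (f n : ℝ) ≤ g (n + ⌈c / 2 * n⌉₊) :=
          le_of_mul_le_mul_left (h1.trans h2) (by linarith)
        exact_mod_cast this
      · exact_mod_cast h3.trans h1
    calc (e n : ℝ) ≤ ⌈c / 2 * n⌉₊ := by exact_mod_cast hfind
      _ ≤ c / 2 * n + 1 := (Nat.ceil_lt_add_one (by positivity)).le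
  obtain ⟨N, hN⟩ := eventually_atTop.1 hevent
  have hlarge : Tendsto (fun n : ℕ => c / 2 * (n : ℝ)) atTop atTop :=
    tendsto_natCast_atTop_atTop.const_mul_atTop (by positivity)
  filter_upwards [hlarge.eventually_ge_atTop (((Finset.range N).sup e : ℕ) : ℝ),
    hlarge.eventually_ge_atTop 1] with n hn1 hn2
  rw [Real.norm_of_nonneg (Nat.cast_nonneg _), Real.norm_of_nonneg (Nat.cast_nonneg _)]
  have hfloor : (Finset.range (n + 1)).sup e ≤ ⌊c * n⌋₊ := by
    refine Finset.sup_le fun j hj => Nat.le_floor ?_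
    have hjn : (j : ℝ) ≤ n := by exact_mod_cast Finset.mem_range_succ_iff.1 hj
    obtain hjN | hjN := lt_or_ge j N
    · have : (e j : ℝ) ≤ ((Finset.range N).sup e : ℕ) := by
        exact_mod_cast Finset.le_sup (f := e) (Finset.mem_range.2 hjN)
      linarith
    · have := hN j hjN
      nlinarith
  exact (Nat.le_floor_iff (by positivity)).1 hfloor

lemma tendsto_densitySeq_of_delay {f g ε : ℕ → ℕ} {V W : ℕ → Option (ℤ × ℤ)} {ρ : ℝ}
    (hf : Monotone f) (h : Tendsto (fun n => (f n : ℝ) / g n) atTop (nhds 1))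
    (hstable : StableUnderSublinearShift f)
    (hε : (fun n => (ε n : ℝ)) =o[atTop] (fun n => (n : ℝ)))
    (hVW : ∀ n, burnSet f V n ⊆ burnSet g W (n + ε n))
    (hWV : ∀ n, burnSet g W n ⊆ burnSet f V (n + ε n))
    (hρ : HasBurningDensity f V ρ) : HasBurningDensity g W ρ := by
  have hshift : Tendsto (fun n => n + ε n) atTop atTop :=
    tendsto_atTop_mono (fun n => Nat.le_add_right n _) tendsto_id
  have hfne : ∀ᶠ n in atTop, (f n : ℝ) ≠ 0 := by
    filter_upwards [h.eventually_ne one_ne_zero] with n hn h0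
    exact hn (by rw [h0, zero_div])
  let k : ℕ → ℕ := fun n => Nat.findGreatest (fun j => j + ε j ≤ n) n
  have hktop : Tendsto k atTop atTop := by
    rw [tendsto_atTop]
    intro b
    filter_upwards [eventually_ge_atTop (b + ε b)] with n hn
    exact Nat.le_findGreatest (by lia) hn
  have hkle : ∀ᶠ n in atTop, k n + ε (k n) ≤ n := by
    filter_upwards [eventually_ge_atTop (ε 0)] with n hn
    exact Nat.findGreatest_spec (P := fun j => j + ε j ≤ n) n.zero_le (by simpa using hn)
  have hklt : ∀ n, n ≤ k n + (1 + ε (k n + 1)) := by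
    intro n
    by_contra! hlt
    have : k n + 1 ≤ k n :=
      Nat.le_findGreatest (P := fun j => j + ε j ≤ n) (by lia) (by lia)
    lia
  have hε' : (fun n => ((1 + ε (n + 1) : ℕ) : ℝ)) =o[atTop] (fun n => (n : ℝ)) := by
    have hone : (fun _ : ℕ => (1 : ℝ)) =o[atTop] (fun n : ℕ => (n : ℝ)) :=
      isLittleO_const_left.2 (Or.inr (tendsto_norm_atTop_atTop.comp tendsto_natCast_atTop_atTop))
    have hsucc : (fun n : ℕ => ((n + 1 : ℕ) : ℝ)) =O[atTop] (fun n : ℕ => (n : ℝ)) := by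
      simpa using (isBigO_refl _ _).add hone.isBigO
    simpa using hone.add ((hε.comp_tendsto (tendsto_add_atTop_nat 1)).trans_isBigO hsucc)
  have hkf : Tendsto (fun n => (f n : ℝ) / f (k n)) atTop (nhds 1) := by
    refine tendsto_of_tendsto_of_tendsto_of_le_of_le' tendsto_const_nhds
      ((hstable _ hε').comp hktop) ?_ ?_
    · filter_upwards [hktop.eventually hfne] with n hn
      rw [one_le_div (lt_of_le_of_ne (Nat.cast_nonneg _) hn.symm)]
      exact_mod_cast hf (Nat.findGreatest_le n)
    · refine .of_forall fun n => ?_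
      simp only [Function.comp_apply]
      gcongr
      exact hf (hklt n)
  have hlow : Tendsto (fun n => (f (k n) : ℝ) / g n) atTop (nhds 1) := by
    have key := (tendsto_div_swap hkf).mul h
    rw [mul_one] at key
    refine key.congr' ?_
    filter_upwards [hfne] with n hn
    rw [div_mul_div_cancel₀ hn]
  have hupp : Tendsto (fun n => (g n : ℝ) / f (n + ε n)) atTop (nhds 1) := by
    have key := (tendsto_div_swap h).mul (tendsto_div_swap (hstable ε hε))
    rw [mul_one] at key
    refine key.congr' ?_
    filter_upwards [hfne] with n hn
    rw [div_mul_div_cancel₀ hn]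
  have hlow' := (Tendsto.comp hρ hktop).mul (tendsto_grid_card_ratio hlow)
  have hupp' := (Tendsto.comp hρ hshift).mul (tendsto_grid_card_ratio (tendsto_div_swap hupp))
  rw [mul_one] at hlow' hupp'
  refine tendsto_of_tendsto_of_tendsto_of_le_of_le' hlow' hupp' ?_ (.of_forall fun n => ?_)
  · filter_upwards [hkle] with n hn
    exact densitySeq_le_mul ((hVW (k n)).trans (burnSet_mono g W hn))
  · have key := densitySeq_le_mul (hWV n)
    rw [← mul_div_assoc, div_le_iff₀ (by positivity)] at key
    rwa [← mul_div_assoc, le_div_iff₀ (by positivity)]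

lemma densSet_subset_of_delay {f g ε : ℕ → ℕ} (hf : Monotone f)
    (h : Tendsto (fun n => (f n : ℝ) / g n) atTop (nhds 1))
    (hstable : StableUnderSublinearShift f) (hmono : Monotone ε)
    (hfg : ∀ n, f n ≤ g (n + ε n)) (hgf : ∀ n, g n ≤ f (n + ε n))
    (hε : (fun n => (ε n : ℝ)) =o[atTop] (fun n => (n : ℝ))) : densSet f ⊆ densSet g := by
  rintro ρ ⟨hρ, V, hV, ⟨t, ht, hVt⟩, hdens⟩
  have hs : StrictMono fun n => n + ε n := strictMono_id.add_monotone hmono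
  refine ⟨hρ, delayedActivator (fun n => n + ε n) V, ?_, ⟨t + ε t, by lia, ?_⟩,
    tendsto_densitySeq_of_delay hf h hstable hε
      (burnSet_subset_burnSet_comp hs hfg ?_) (burnSet_subset_burnSet_comp hs hgf ?_) hdens⟩
  · intro n _ p hp
    obtain ⟨k, rfl, hk⟩ := exists_of_delayedActivator_eq_some hs hp
    exact (hV (k + 1) (by lia) p hk).of_le (hfg (k + 1))
  · obtain ⟨k, rfl⟩ : ∃ k, t = k + 1 := ⟨t - 1, by lia⟩
    have := delayedActivator_apply hs V k
    simpa only [this] using hVt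
  · intro n p hp
    refine mem_burnSet_of_activated (k := n + ε (n + 1)) ?_ (by lia)
    rw [← hp, ← delayedActivator_apply hs V n]
    congr 1
    lia
  · intro n p hp
    obtain ⟨k, hkn, hk⟩ := exists_of_delayedActivator_eq_some hs hp
    exact mem_burnSet_of_activated hk (by lia)

lemma densSet_eq_of_controlledGrowth {f g : ℕ → ℕ} (hf : Monotone f) (hg : Monotone g)
    (hcg : ControlledGrowth f) (h : Tendsto (fun n => (f n : ℝ) / g n) atTop (nhds 1)) :
    densSet f = densSet g := by
  obtain ⟨ε, hmono, hfg, hgf, hε⟩ := exists_sublinear_delay hf hg hcg h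
  have hstable : StableUnderSublinearShift f := hcg.2.1
  exact (densSet_subset_of_delay hf h hstable hmono hfg hgf hε).antisymm
    (densSet_subset_of_delay hg (tendsto_div_swap h) (hstable.congr h) hmono hgf hfg hε)

/-- if `f, g` are increasing, one of them has controlled growth, and
`f(n)/g(n) → 1`, then `P(G(f)) = P(G(g))`. -/
theorem densSet_eq_of_ratio_one (f g : ℕ → ℕ)
    (hf : Monotone f) (hg : Monotone g)
    (hcg : ControlledGrowth f ∨ ControlledGrowth g)
    (hlim : Tendsto (fun n => (f n : ℝ) / (g n : ℝ)) atTop (nhds 1)) :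
    densSet f = densSet g := by
  obtain hcg | hcg := hcg
  · exact densSet_eq_of_controlledGrowth hf hg hcg hlim
  · exact (densSet_eq_of_controlledGrowth hg hf hcg (tendsto_div_swap hlim)).symm
end

section
/- Let g(n) = ⌈n^{4/3}⌉ and define f : ℕ → ℕ by f(1) = g(1) = 1 and, for n ≥ 2, f(n) = g(n) if n = 2^k for some k ∈ ℕ and f(n) = f(n−1) otherwise. Then f(n) = Θ(n^{4/3}) (in particular f(n) = ω(n) and f(n) = o(n^{3/2})), yet every activator sequence V on G(f) for which the burning density δ(G(f),V) exists has δ(G(f),V) = 0; in particular P(G(f)) ≠ [0,1]. -/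
open Filter Asymptotics

/-- One burning step at most quintuples the burning set, up to one activated vertex. -/
theorem card_burnSet_succ_le (f : ℕ → ℕ) (V : ℕ → Option (ℤ × ℤ)) (n : ℕ) :
    (burnSet f V (n + 1)).card ≤ 5 * (burnSet f V n).card + 1 := by
  have hnbrs : ((burnSet f V n).biUnion nbrs).card ≤ (burnSet f V n).card * 4 :=
    Finset.card_biUnion_le_card_mul _ _ _ fun _ _ => Finset.card_le_four
  have hspread : (burnSet f V n ∪
      ((burnSet f V n).biUnion nbrs).filter (inGrid f (n + 1))).card ≤
        5 * (burnSet f V n).card := by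
    have h₁ := Finset.card_union_le (burnSet f V n)
      (((burnSet f V n).biUnion nbrs).filter (inGrid f (n + 1)))
    have h₂ := Finset.card_filter_le ((burnSet f V n).biUnion nbrs) (inGrid f (n + 1))
    omega
  rw [burnSet]
  cases V (n + 1) with
  | none => exact hspread.trans (Nat.le_succ _)
  | some v => exact (Finset.card_insert_le _ _).trans (Nat.succ_le_succ hspread)

/-- A function that is only updated at powers of two depends on `Nat.log 2 n` alone. -/
theorem eq_apply_two_pow_log {g f : ℕ → ℕ} (h1 : f 1 = g 1)
    (hf : ∀ n, 2 ≤ n → (∃ k, n = 2 ^ k) → f n = g n)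
    (hf' : ∀ n, 2 ≤ n → (¬ ∃ k, n = 2 ^ k) → f n = f (n - 1)) {n : ℕ} (hn : 1 ≤ n) :
    f n = g (2 ^ Nat.log 2 n) := by
  induction n, hn using Nat.le_induction with
  | base => simpa using h1
  | succ n hn ih =>
    by_cases hk : ∃ k, n + 1 = 2 ^ k
    · rw [hf _ (by omega) hk]
      obtain ⟨k, hk⟩ := hk
      rw [hk, Nat.log_pow one_lt_two]
    · rw [hf' _ (by omega) hk, Nat.add_sub_cancel, ih]
      have hlow : 2 ^ Nat.log 2 n ≤ n := Nat.pow_log_le_self 2 (by omega)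
      have hup : n < 2 ^ (Nat.log 2 n + 1) := Nat.lt_pow_succ_log_self one_lt_two n
      have hne : n + 1 ≠ 2 ^ (Nat.log 2 n + 1) := fun h => hk ⟨_, h⟩
      rw [(Nat.log_eq_iff (Or.inr ⟨one_lt_two, by omega⟩)).2
        ⟨hlow.trans n.le_succ, lt_of_le_of_ne hup hne⟩]

theorem five_halves_le_two_rpow_four_thirds : (5 / 2 : ℝ) ≤ 2 ^ ((4 : ℝ) / 3) := by
  refine le_of_pow_le_pow_left₀ three_ne_zero (by positivity) ?_
  rw [← Real.rpow_natCast (2 ^ ((4 : ℝ) / 3)) 3, ← Real.rpow_mul two_pos.le]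
  norm_num

theorem two_rpow_four_thirds_le_four : (2 : ℝ) ^ ((4 : ℝ) / 3) ≤ 4 := by
  calc (2 : ℝ) ^ ((4 : ℝ) / 3) ≤ 2 ^ (2 : ℝ) :=
        Real.rpow_le_rpow_of_exponent_le one_le_two (by norm_num)
    _ = 4 := by norm_num

theorem isLittleO_rpow_rpow_atTop {p q : ℝ} (hpq : p < q) :
    (fun x : ℝ => x ^ p) =o[atTop] fun x : ℝ => x ^ q := by
  refine (isLittleO_iff_tendsto' ((eventually_gt_atTop 0).mono fun x hx h =>
    absurd h (Real.rpow_pos_of_pos hx q).ne')).2 ?_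
  refine (tendsto_rpow_neg_atTop (sub_pos.2 hpq)).congr'
    ((eventually_gt_atTop 0).mono fun x hx => ?_)
  rw [neg_sub, Real.rpow_sub hx]

/-- If the side of the grid is multiplied by nearly `5 / 2` in a single step infinitely often,
then every burning density that exists is zero. -/
theorem HasBurningDensity.eq_zero_of_frequent_jump {f : ℕ → ℕ} {V : ℕ → Option (ℤ × ℤ)} {ρ : ℝ}
    (hρ : HasBurningDensity f V ρ) (hf : Tendsto f atTop atTop)
    (hjump : ∃ᶠ n in atTop, 25 * (2 * (f n : ℝ) + 1) ≤ 11 * (2 * (f (n + 1) : ℝ) + 1)) :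
    ρ = 0 := by
  have hnonneg : 0 ≤ ρ :=
    ge_of_tendsto' hρ fun n => div_nonneg (Nat.cast_nonneg _) (sq_nonneg _)
  have hcast : Tendsto (fun n => (2 * (f (n + 1) : ℝ) + 1) ^ 2) atTop atTop := by
    have h : Tendsto (fun n => (f (n + 1) : ℝ)) atTop atTop :=
      tendsto_natCast_atTop_atTop.comp (hf.comp (tendsto_add_atTop_nat 1))
    exact (tendsto_pow_atTop two_ne_zero).comp
      (tendsto_atTop_add_const_right _ _ (h.const_mul_atTop two_pos))
  have hlim : Tendsto (fun n => densitySeq f V (n + 1) -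
      (121 / 125 * densitySeq f V n + ((2 * (f (n + 1) : ℝ) + 1) ^ 2)⁻¹)) atTop
      (nhds (ρ - (121 / 125 * ρ + 0))) :=
    (hρ.comp (tendsto_add_atTop_nat 1)).sub
      ((Tendsto.const_mul _ hρ).add (tendsto_inv_atTop_zero.comp hcast))
  have hle : ρ - (121 / 125 * ρ + 0) ≤ 0 := by
    refine le_of_tendsto_of_frequently hlim (hjump.mono fun n hn => ?_)
    have hcard : ((burnSet f V (n + 1)).card : ℝ) ≤ 5 * (burnSet f V n).card + 1 :=
      mod_cast card_burnSet_succ_le f V n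
    have ha : (0 : ℝ) < 2 * (f n : ℝ) + 1 := by positivity
    have hb : (0 : ℝ) < 2 * (f (n + 1) : ℝ) + 1 := by positivity
    have hB : (0 : ℝ) ≤ (burnSet f V n).card := Nat.cast_nonneg _
    unfold densitySeq
    generalize 2 * (f n : ℝ) + 1 = a at *
    generalize 2 * (f (n + 1) : ℝ) + 1 = b at *
    have hsq : 625 * a ^ 2 ≤ 121 * b ^ 2 := by nlinarith
    have hinv : 5 / b ^ 2 ≤ 121 / 125 / a ^ 2 := by
      rw [div_le_div_iff₀ (by positivity) (by positivity)]
      linarith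
    have h₁ := div_le_div_of_nonneg_right hcard (sq_nonneg b)
    have h₂ := mul_le_mul_of_nonneg_left hinv hB
    have h₃ : (5 * ((burnSet f V n).card : ℝ) + 1) / b ^ 2 =
        (burnSet f V n).card * (5 / b ^ 2) + (b ^ 2)⁻¹ := by ring
    have h₄ : 121 / 125 * (((burnSet f V n).card : ℝ) / a ^ 2) =
        (burnSet f V n).card * (121 / 125 / a ^ 2) := by ring
    linarith
  linarith

open Classical in
/-- the doubling-jump modification `f` of `g(n) = ⌈n^(4/3)⌉` satisfies
`f(n) = Θ(n^(4/3))` (in particular `f = ω(n)` and `f = o(n^(3/2))`), yet every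
activator sequence whose burning density exists has density `0`;
in particular `P(G(f)) ≠ [0,1]`. -/
theorem controlled_growth_needed (g f : ℕ → ℕ)
    (hg : ∀ n, g n = ⌈(n : ℝ) ^ ((4 : ℝ) / 3)⌉₊)
    (hf1 : f 1 = 1)
    (hf : ∀ n, 2 ≤ n → f n = if ∃ k : ℕ, n = 2 ^ k then g n else f (n - 1)) :
    ((fun n => (f n : ℝ)) =Θ[atTop] fun n => (n : ℝ) ^ ((4 : ℝ) / 3)) ∧
    ((fun n : ℕ => (n : ℝ)) =o[atTop] fun n => (f n : ℝ)) ∧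
    ((fun n => (f n : ℝ)) =o[atTop] fun n => (n : ℝ) ^ ((3 : ℝ) / 2)) ∧
    (∀ V : ℕ → Option (ℤ × ℤ), IsActivator f V →
      ∀ ρ : ℝ, HasBurningDensity f V ρ → ρ = 0) ∧
    densSet f ≠ Set.Icc 0 1 := by
  have hfg : ∀ n, 1 ≤ n → f n = g (2 ^ Nat.log 2 n) := fun n hn =>
    eq_apply_two_pow_log (by rw [hf1, hg]; simp) (fun n hn h => by rw [hf n hn, if_pos h])
      (fun n hn h => by rw [hf n hn, if_neg h]) hn
  have hg_ge : ∀ n : ℕ, (n : ℝ) ^ ((4 : ℝ) / 3) ≤ g n := fun n => hg n ▸ Nat.le_ceil _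
  have hg_le : ∀ n : ℕ, (g n : ℝ) ≤ (n : ℝ) ^ ((4 : ℝ) / 3) + 1 := fun n =>
    hg n ▸ (Nat.ceil_lt_add_one (by positivity)).le
  have hupper : ∀ n : ℕ, 1 ≤ n → (f n : ℝ) ≤ 2 * (n : ℝ) ^ ((4 : ℝ) / 3) := by
    intro n hn
    have hlog : ((2 ^ Nat.log 2 n : ℕ) : ℝ) ≤ n := mod_cast Nat.pow_log_le_self 2 (by omega)
    have hone : (1 : ℝ) ≤ (n : ℝ) ^ ((4 : ℝ) / 3) :=
      Real.one_le_rpow (mod_cast hn) (by norm_num)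
    rw [hfg n hn]
    linarith [hg_le (2 ^ Nat.log 2 n),
      Real.rpow_le_rpow (Nat.cast_nonneg _) hlog (by norm_num : (0 : ℝ) ≤ 4 / 3)]
  have hlower : ∀ n : ℕ, 1 ≤ n → (n : ℝ) ^ ((4 : ℝ) / 3) ≤ 4 * f n := by
    intro n hn
    have hlog : (n : ℝ) ≤ 2 * (2 ^ Nat.log 2 n : ℕ) := by
      have h := (Nat.lt_pow_succ_log_self one_lt_two n).le
      rw [pow_succ'] at h
      exact_mod_cast h
    rw [hfg n hn]
    calc (n : ℝ) ^ ((4 : ℝ) / 3)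
        ≤ (2 * (2 ^ Nat.log 2 n : ℕ)) ^ ((4 : ℝ) / 3) :=
          Real.rpow_le_rpow (Nat.cast_nonneg _) hlog (by norm_num)
      _ = 2 ^ ((4 : ℝ) / 3) * ((2 ^ Nat.log 2 n : ℕ) : ℝ) ^ ((4 : ℝ) / 3) :=
          Real.mul_rpow two_pos.le (Nat.cast_nonneg _)
      _ ≤ 4 * g (2 ^ Nat.log 2 n) :=
          mul_le_mul two_rpow_four_thirds_le_four (hg_ge _) (by positivity) (by norm_num)
  have htheta : (fun n => (f n : ℝ)) =Θ[atTop] fun n => (n : ℝ) ^ ((4 : ℝ) / 3) := by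
    constructor
    · refine IsBigO.of_bound 2 ((eventually_ge_atTop 1).mono fun n hn => ?_)
      rw [Real.norm_of_nonneg (by positivity), Real.norm_of_nonneg (by positivity)]
      exact hupper n hn
    · refine IsBigO.of_bound 4 ((eventually_ge_atTop 1).mono fun n hn => ?_)
      rw [Real.norm_of_nonneg (by positivity), Real.norm_of_nonneg (by positivity)]
      exact hlower n hn
  have hrpow : ∀ {p q : ℝ}, p < q →
      (fun n : ℕ => (n : ℝ) ^ p) =o[atTop] fun n : ℕ => (n : ℝ) ^ q := fun hpq =>
    (isLittleO_rpow_rpow_atTop hpq).comp_tendsto tendsto_natCast_atTop_atTop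
  have homega : (fun n : ℕ => (n : ℝ)) =o[atTop] fun n => (f n : ℝ) := by
    have h := hrpow (p := 1) (q := 4 / 3) (by norm_num)
    simp only [Real.rpow_one] at h
    exact h.trans_isTheta htheta.symm
  have hftop : Tendsto f atTop atTop := by
    rw [← tendsto_natCast_atTop_iff (R := ℝ)]
    have hpow : Tendsto (fun n : ℕ => (n : ℝ) ^ ((4 : ℝ) / 3)) atTop atTop :=
      (tendsto_rpow_atTop (by norm_num)).comp tendsto_natCast_atTop_atTop
    exact (tendsto_atTop_mono' _ ((eventually_ge_atTop 1).mono hlower) hpow).atTop_of_const_mul₀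
      (by norm_num)
  have hjump : ∃ᶠ n in atTop, 25 * (2 * (f n : ℝ) + 1) ≤ 11 * (2 * (f (n + 1) : ℝ) + 1) := by
    refine frequently_atTop.2 fun N => ⟨2 ^ (N + 4 + 1) - 1, ?_, ?_⟩
    · have := Nat.lt_two_pow_self (n := N + 4 + 1)
      omega
    set k := N + 4 with hk
    have hpos : 1 ≤ 2 ^ k := Nat.one_le_two_pow
    have hsucc : 2 ^ (k + 1) = 2 * 2 ^ k := pow_succ' 2 k
    have hlog : Nat.log 2 (2 ^ (k + 1) - 1) = k :=
      (Nat.log_eq_iff (Or.inr ⟨one_lt_two, by omega⟩)).2 ⟨by omega, by omega⟩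
    rw [hfg (2 ^ (k + 1) - 1) (by omega), hlog, Nat.sub_add_cancel (by omega),
      hfg (2 ^ (k + 1)) (by omega), Nat.log_pow one_lt_two]
    have hx : (16 : ℝ) ≤ ((2 ^ k : ℕ) : ℝ) ^ ((4 : ℝ) / 3) := by
      have h16 : (16 : ℝ) ≤ (2 ^ k : ℕ) := by
        have : 2 ^ 4 ≤ 2 ^ k := Nat.pow_le_pow_right two_pos (by omega)
        exact_mod_cast this
      exact h16.trans (Real.self_le_rpow_of_one_le (by linarith) (by norm_num))
    have hstep : ((2 ^ (k + 1) : ℕ) : ℝ) ^ ((4 : ℝ) / 3) =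
        2 ^ ((4 : ℝ) / 3) * ((2 ^ k : ℕ) : ℝ) ^ ((4 : ℝ) / 3) := by
      rw [hsucc, Nat.cast_mul, Nat.cast_two, Real.mul_rpow two_pos.le (Nat.cast_nonneg _)]
    have hmul := mul_le_mul_of_nonneg_right five_halves_le_two_rpow_four_thirds
      (by linarith : (0 : ℝ) ≤ ((2 ^ k : ℕ) : ℝ) ^ ((4 : ℝ) / 3))
    linarith [hg_le (2 ^ k), hg_ge (2 ^ (k + 1))]
  refine ⟨htheta, homega, htheta.trans_isLittleO (hrpow (by norm_num)),
    fun V _ ρ hρ => hρ.eq_zero_of_frequent_jump hftop hjump, fun h => ?_⟩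
  have hone : (1 : ℝ) ∈ densSet f := h ▸ Set.right_mem_Icc.2 zero_le_one
  obtain ⟨-, V, -, -, hV⟩ := hone
  exact one_ne_zero (hV.eq_zero_of_frequent_jump hftop hjump)
end

section
/- Fix c > 0 and let f(n) = ⌈c·n^{3/2}⌉. Then there exists a non-empty activator sequence V on G(f) such that the burning density exists and equals δ(G(f),V) = (1+√6·c)^{-2}. -/
open Filter Asymptotics

/-- The closed `L¹`-ball of radius `r` around `p` in `ℤ × ℤ`. -/
noncomputable def diamond (p : ℤ × ℤ) (r : ℕ) : Finset (ℤ × ℤ) :=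
  (Finset.Icc (p.1 - r) (p.1 + r) ×ˢ Finset.Icc (p.2 - r) (p.2 + r)).filter
    fun q => |q.1 - p.1| + |q.2 - p.2| ≤ r

lemma mem_diamond {p q : ℤ × ℤ} {r : ℕ} :
    q ∈ diamond p r ↔ |q.1 - p.1| + |q.2 - p.2| ≤ r := by
  simp only [diamond, Finset.mem_filter, Finset.mem_product, Finset.mem_Icc, and_iff_right_iff_imp]
  intro h
  have h1 := abs_le.1 ((le_add_of_nonneg_right (abs_nonneg (q.2 - p.2))).trans h)
  have h2 := abs_le.1 ((le_add_of_nonneg_left (abs_nonneg (q.1 - p.1))).trans h)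
  omega

/-- The colouring of `ℤ × ℤ` whose residue classes modulo `2 r ^ 2 + 2 r + 1` are the perfect
`r`-error-correcting Lee codes. -/
def leeColor (r : ℕ) (p : ℤ × ℤ) : ℤ := r * p.1 + (r + 1) * p.2

lemma eq_of_leeColor_modEq {r : ℕ} {p q : ℤ × ℤ} (hpq : |p.1 - q.1| + |p.2 - q.2| ≤ 2 * r)
    (h : leeColor r p ≡ leeColor r q [ZMOD (2 * r ^ 2 + 2 * r + 1 : ℕ)]) : p = q := by
  obtain ⟨x, y⟩ := p
  obtain ⟨x', y'⟩ := q
  have hd := h.symm.dvd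
  simp only [leeColor] at hd hpq
  obtain ⟨a, ha⟩ : ∃ a, a = x - x' := ⟨_, rfl⟩
  obtain ⟨b, hb⟩ : ∃ b, b = y - y' := ⟨_, rfl⟩
  rw [← ha, ← hb] at hpq
  have hr : (0 : ℤ) ≤ r := by positivity
  have hz : (r : ℤ) * x + (r + 1) * y - (r * x' + (r + 1) * y') = r * a + (r + 1) * b := by
    rw [ha, hb]; ring
  rw [hz] at hd
  have hlt : |(r : ℤ) * a + (r + 1) * b| < (2 * r ^ 2 + 2 * r + 1 : ℕ) := by
    have h1 := abs_add_le ((r : ℤ) * a) ((r + 1) * b)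
    rw [abs_mul, abs_mul, abs_of_nonneg hr, abs_of_nonneg (by positivity : (0 : ℤ) ≤ r + 1)] at h1
    push_cast
    nlinarith [abs_nonneg a, abs_nonneg b]
  have h0 := Int.eq_zero_of_abs_lt_dvd hd hlt
  have hs : (r : ℤ) * (a + b) = -b := by linarith
  have hb' : b = -(r * (a + b)) := by linarith
  have ha' : a = (r + 1) * (a + b) := by linarith
  have hab : a + b = 0 := by
    by_contra hne
    have h1 : 1 ≤ |a + b| := Int.one_le_abs hne
    have e1 : |a| = (r + 1) * |a + b| := by
      conv_lhs => rw [ha']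
      rw [abs_mul, abs_of_nonneg (by positivity : (0 : ℤ) ≤ r + 1)]
    have e2 : |b| = r * |a + b| := by
      conv_lhs => rw [hb']
      rw [abs_neg, abs_mul, abs_of_nonneg hr]
    nlinarith
  rw [hab] at ha' hb'
  simp only [mul_zero, neg_zero] at ha' hb'
  ext <;> simp only <;> omega

lemma card_diamond_le (p : ℤ × ℤ) (r : ℕ) : (diamond p r).card ≤ 2 * r ^ 2 + 2 * r + 1 := by
  have hN : (0 : ℤ) < (2 * r ^ 2 + 2 * r + 1 : ℕ) := by positivity
  have := Finset.card_le_card_of_injOn (s := diamond p r)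
    (t := Finset.Ico (0 : ℤ) (2 * r ^ 2 + 2 * r + 1 : ℕ))
    (fun q => leeColor r q % (2 * r ^ 2 + 2 * r + 1 : ℕ))
    (fun q _ => Finset.mem_Ico.2 ⟨Int.emod_nonneg _ hN.ne', Int.emod_lt_of_pos _ hN⟩) ?_
  · rwa [Int.card_Ico, sub_zero, Int.toNat_natCast] at this
  · intro q hq q' hq' h
    have h1 := mem_diamond.1 hq
    have h2 := mem_diamond.1 hq'
    refine eq_of_leeColor_modEq ?_ h
    have h3 := abs_sub_le q.1 p.1 q'.1
    have h4 := abs_sub_le q.2 p.2 q'.2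
    rw [abs_sub_comm p.1] at h3
    rw [abs_sub_comm p.2] at h4
    linarith

lemma two_mul_sq_le_card_diamond (p : ℤ × ℤ) (r : ℕ) : 2 * r ^ 2 ≤ (diamond p r).card := by
  have := Finset.card_le_card_of_injOn
    (s := (Finset.range r ×ˢ Finset.range r) ×ˢ Finset.range 2) (t := diamond p r)
    (fun x => (p.1 + (x.1.1 + x.1.2 + x.2 - r), p.2 + (x.1.1 - x.1.2))) ?_ ?_
  · simp only [Finset.card_product, Finset.card_range] at this
    linarith
  · rintro ⟨⟨i, j⟩, e⟩ hx
    simp only [Finset.coe_product, Finset.coe_range, Set.mem_prod, Set.mem_Iio] at hx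
    refine mem_diamond.2 ?_
    simp only [add_sub_cancel_left]
    rcases abs_cases ((i : ℤ) + j + e - r) with h1 | h1 <;>
      rcases abs_cases ((i : ℤ) - j) with h2 | h2 <;> omega
  · rintro ⟨⟨i, j⟩, e⟩ hx ⟨⟨i', j'⟩, e'⟩ hx' h
    simp only [Finset.coe_product, Finset.coe_range, Set.mem_prod, Set.mem_Iio] at hx hx'
    simp only [Prod.mk.injEq] at h ⊢
    omega

/-- Every finite set `A` in the plane lattice contains `|A| / (2 r ^ 2 + 2 r + 1)` points with
pairwise `L¹`-distance greater than `2 r`. -/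
lemma exists_separated (A : Finset (ℤ × ℤ)) (r L : ℕ)
    (h : L * (2 * r ^ 2 + 2 * r + 1) ≤ A.card) :
    ∃ e : ℕ → ℤ × ℤ, ∀ i < L, e i ∈ A ∧
      ∀ j < L, |(e i).1 - (e j).1| + |(e i).2 - (e j).2| ≤ 2 * r → i = j := by
  have hN : (0 : ℤ) < (2 * r ^ 2 + 2 * r + 1 : ℕ) := by positivity
  obtain ⟨y, -, hy⟩ := Finset.exists_le_card_fiber_of_mul_le_card_of_maps_to
    (s := A) (t := Finset.Ico (0 : ℤ) (2 * r ^ 2 + 2 * r + 1 : ℕ)) (n := L)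
    (f := fun q => leeColor r q % (2 * r ^ 2 + 2 * r + 1 : ℕ))
    (fun q _ => Finset.mem_Ico.2 ⟨Int.emod_nonneg _ hN.ne', Int.emod_lt_of_pos _ hN⟩)
    ⟨0, by simpa using hN⟩ (by rw [Int.card_Ico, sub_zero, Int.toNat_natCast]; linarith)
  set S := A.filter fun q => leeColor r q % (2 * r ^ 2 + 2 * r + 1 : ℕ) = y
  have hmem (i : Fin S.card) := Finset.mem_filter.1 (S.equivFin.symm i).2
  refine ⟨fun i => if hi : i < S.card then (S.equivFin.symm ⟨i, hi⟩ : ℤ × ℤ) else 0,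
    fun i hi => ?_⟩
  beta_reduce
  rw [dif_pos (hi.trans_le hy)]
  refine ⟨(hmem _).1, fun j hj hd => ?_⟩
  beta_reduce at hd
  rw [dif_pos (hj.trans_le hy)] at hd
  have := eq_of_leeColor_modEq hd ((hmem _).2.trans (hmem _).2.symm)
  simpa using S.equivFin.symm.injective (Subtype.ext this)

lemma mem_burnSet_of_adj {f : ℕ → ℕ} {V : ℕ → Option (ℤ × ℤ)} {n : ℕ} {p q : ℤ × ℤ}
    (hp : p ∈ burnSet f V n) (hq : q ∈ nbrs p) (hg : inGrid f (n + 1) q) :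
    q ∈ burnSet f V (n + 1) := by
  have : q ∈ (burnSet f V n).biUnion nbrs := Finset.mem_biUnion.2 ⟨p, hp, hq⟩
  rw [burnSet]
  cases V (n + 1) <;> simp only [Finset.mem_insert, Finset.mem_union, Finset.mem_filter] <;> tauto

lemma diamond_succ_subset {p q : ℤ × ℤ} {j : ℕ} (hq : q ∈ diamond p (j + 1)) :
    q ∈ diamond p j ∨ ∃ q' ∈ diamond p j, q ∈ nbrs q' := by
  obtain ⟨x, y⟩ := p
  obtain ⟨a, b⟩ := q
  simp only [mem_diamond, nbrs, Finset.mem_insert, Finset.mem_singleton, Prod.mk.injEq,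
    Prod.exists] at hq ⊢
  rcases lt_trichotomy a x with h | h | h
  · refine .inr ⟨a + 1, b, ?_, by simp⟩
    rw [abs_of_nonpos (by omega)] at hq ⊢; push_cast at hq; omega
  · rcases lt_trichotomy b y with h' | h' | h'
    · refine .inr ⟨a, b + 1, ?_, by simp⟩
      rw [abs_of_nonpos (by omega : b + 1 - y ≤ 0)]
      rw [abs_of_nonpos (by omega : b - y ≤ 0)] at hq; push_cast at hq; omega
    · left; simp [h, h']
    · refine .inr ⟨a, b - 1, ?_, by simp⟩
      rw [abs_of_nonneg (by omega : 0 ≤ b - 1 - y)]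
      rw [abs_of_nonneg (by omega : 0 ≤ b - y)] at hq; push_cast at hq; omega
  · refine .inr ⟨a - 1, b, ?_, by simp⟩
    rw [abs_of_nonneg (by omega)] at hq ⊢; push_cast at hq; omega

/-- The fire started at `p` fills the diamond of radius `j` after `j` steps, if the grid does not
stand in its way. -/
lemma diamond_subset_burnSet {f : ℕ → ℕ} {V : ℕ → Option (ℤ × ℤ)} {t s : ℕ} {p : ℤ × ℤ}
    (ht : 1 ≤ t) (hV : V t = some p) (hg : ∀ q ∈ diamond p s, ∀ n, t ≤ n → inGrid f n q)
    {j : ℕ} (hj : j ≤ s) : diamond p j ⊆ burnSet f V (t + j) := by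
  induction j with
  | zero =>
    intro q hq
    have h := mem_diamond.1 hq
    have h1 := abs_nonneg (q.1 - p.1)
    have h2 := abs_nonneg (q.2 - p.2)
    have h3 : |q.1 - p.1| = 0 := by push_cast at h; omega
    have h4 : |q.2 - p.2| = 0 := by push_cast at h; omega
    rw [abs_eq_zero, sub_eq_zero] at h3 h4
    obtain rfl : q = p := Prod.ext h3 h4
    obtain ⟨n, rfl⟩ : ∃ n, t = n + 1 := ⟨t - 1, by omega⟩
    rw [add_zero, burnSet, hV]
    simp
  | succ j ih =>
    intro q hq
    specialize ih (by omega)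
    rcases diamond_succ_subset hq with h | ⟨q', h, h'⟩
    · exact burnSet_mono f V (by omega : t + j ≤ t + (j + 1)) (ih h)
    · refine mem_burnSet_of_adj (ih h) h' (hg q ?_ _ (Nat.le_add_right t (j + 1)))
      rw [mem_diamond] at hq ⊢
      exact hq.trans (by exact_mod_cast hj)

lemma exists_diamond_of_mem_burnSet {f : ℕ → ℕ} {V : ℕ → Option (ℤ × ℤ)} {n : ℕ} {q : ℤ × ℤ}
    (hq : q ∈ burnSet f V n) :
    ∃ t, 1 ≤ t ∧ t ≤ n ∧ ∃ p, V t = some p ∧ q ∈ diamond p (n - t) := by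
  induction n generalizing q with
  | zero => simp [burnSet] at hq
  | succ n ih =>
    have key : (∃ q' ∈ burnSet f V n, q = q' ∨ q ∈ nbrs q') ∨ V (n + 1) = some q := by
      rw [burnSet] at hq
      cases hV : V (n + 1) <;> rw [hV] at hq <;>
        simp only [Finset.mem_insert, Finset.mem_union, Finset.mem_filter,
          Finset.mem_biUnion] at hq
      · rcases hq with h | ⟨⟨q', h, h'⟩, -⟩
        exacts [.inl ⟨q, h, .inl rfl⟩, .inl ⟨q', h, .inr h'⟩]
      · rcases hq with h | h | ⟨⟨q', h, h'⟩, -⟩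
        exacts [.inr (by rw [h]), .inl ⟨q, h, .inl rfl⟩, .inl ⟨q', h, .inr h'⟩]
    rcases key with ⟨q', hq', h⟩ | h
    · obtain ⟨t, h1, h2, p, hp, hd⟩ := ih hq'
      refine ⟨t, h1, by omega, p, hp, ?_⟩
      rw [mem_diamond] at hd ⊢
      have hcast : ((n + 1 - t : ℕ) : ℤ) = ((n - t : ℕ) : ℤ) + 1 := by omega
      rw [hcast]
      rcases h with rfl | h
      · omega
      · have e1 := abs_sub_le q.1 q'.1 p.1
        have e2 := abs_sub_le q.2 q'.2 p.2
        have e3 : |q.1 - q'.1| + |q.2 - q'.2| = 1 := by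
          simp only [nbrs, Finset.mem_insert, Finset.mem_singleton] at h
          rcases h with rfl | rfl | rfl | rfl <;> simp
        linarith
    · exact ⟨n + 1, by omega, le_rfl, q, h, mem_diamond.2 (by simp)⟩

/-- The square `[-a, a]²` in the plane lattice. -/
noncomputable def box (a : ℕ) : Finset (ℤ × ℤ) := Finset.Icc (-(a : ℤ)) a ×ˢ Finset.Icc (-(a : ℤ)) a

lemma mem_box {a : ℕ} {p : ℤ × ℤ} : p ∈ box a ↔ |p.1| ≤ a ∧ |p.2| ≤ a := by
  simp [box, abs_le]

lemma card_box (a : ℕ) : (box a).card = (2 * a + 1) ^ 2 := by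
  have : ((a : ℤ) + 1 - -a).toNat = 2 * a + 1 := by omega
  rw [box, Finset.card_product, Int.card_Icc, this, sq]

/-- Fires started up to time `m` stay in a box; the later ones burn at most their full diamonds. -/
lemma card_burnSet_le {f : ℕ → ℕ} {V : ℕ → Option (ℤ × ℤ)} (hf : Monotone f)
    (hV : IsActivator f V) {m n : ℕ} (hmn : m ≤ n) :
    (burnSet f V n).card ≤
      (2 * (f m + n) + 1) ^ 2 + ∑ j ∈ Finset.range (n - m), (2 * j ^ 2 + 2 * j + 1) := by
  have hsub : burnSet f V n ⊆ box (f m + n) ∪ (Finset.range (n - m)).biUnion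
      fun j => diamond ((V (n - j)).getD 0) j := by
    intro q hq
    obtain ⟨t, h1, h2, p, hp, hd⟩ := exists_diamond_of_mem_burnSet hq
    rw [Finset.mem_union]
    rcases le_or_gt t m with h | h
    · left
      rw [mem_diamond] at hd
      obtain ⟨g1, g2⟩ := hV t h1 p hp
      have hfm : (f t : ℤ) ≤ f m := by exact_mod_cast hf h
      have e1 := abs_sub_abs_le_abs_sub q.1 p.1
      have e2 := abs_sub_abs_le_abs_sub q.2 p.2
      have e3 := abs_nonneg (q.1 - p.1)
      have e4 := abs_nonneg (q.2 - p.2)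
      rw [mem_box]
      push_cast
      omega
    · right
      refine Finset.mem_biUnion.2 ⟨n - t, Finset.mem_range.2 (by omega), ?_⟩
      rwa [Nat.sub_sub_self h2, hp]
  refine (Finset.card_le_card hsub).trans ((Finset.card_union_le _ _).trans ?_)
  rw [card_box]
  gcongr
  exact Finset.card_biUnion_le.trans (Finset.sum_le_sum fun j _ => card_diamond_le _ _)

/-- Fires started at the centres of pairwise disjoint diamonds contained in the grid do not
interact before filling these diamonds. -/
lemma le_card_burnSet {f : ℕ → ℕ} {V : ℕ → Option (ℤ × ℤ)} (hf : Monotone f)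
    {v : ℕ → ℤ × ℤ} {s : ℕ → ℕ} {t₀ : ℕ} (ht₀ : 1 ≤ t₀) (hV : ∀ t, t₀ ≤ t → V t = some (v t))
    (hg : ∀ t, t₀ ≤ t → |(v t).1| + s t ≤ f t ∧ |(v t).2| + s t ≤ f t)
    (hs : ∀ t u, t₀ ≤ t → t < u → (s t + s u : ℤ) < |(v t).1 - (v u).1| + |(v t).2 - (v u).2|)
    (n : ℕ) :
    ∑ t ∈ Finset.Ico t₀ (n + 1), 2 * (min (n - t) (s t)) ^ 2 ≤ (burnSet f V n).card := by
  have hsub : (Finset.Ico t₀ (n + 1)).biUnion (fun t => diamond (v t) (min (n - t) (s t)))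
      ⊆ burnSet f V n := by
    refine Finset.biUnion_subset.2 fun t ht => ?_
    rw [Finset.mem_Ico] at ht
    refine (diamond_subset_burnSet (ht₀.trans ht.1) (hV t ht.1) ?_ (min_le_right _ _)).trans
      (burnSet_mono f V (by omega : t + min (n - t) (s t) ≤ n))
    intro q hq k hk
    rw [mem_diamond] at hq
    obtain ⟨g1, g2⟩ := hg t ht.1
    have hfm : (f t : ℤ) ≤ f k := by exact_mod_cast hf hk
    have e1 := abs_sub_abs_le_abs_sub q.1 (v t).1
    have e2 := abs_sub_abs_le_abs_sub q.2 (v t).2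
    have e3 := abs_nonneg (q.1 - (v t).1)
    have e4 := abs_nonneg (q.2 - (v t).2)
    constructor <;> omega
  refine le_trans ?_ (Finset.card_le_card hsub)
  have hdis : ∀ t u, t₀ ≤ t → t < u →
      Disjoint (diamond (v t) (min (n - t) (s t))) (diamond (v u) (min (n - u) (s u))) := by
    intro t u ht htu
    refine Finset.disjoint_left.2 fun q h1 h2 => ?_
    rw [mem_diamond] at h1 h2
    have h3 := hs t u ht htu
    have h4 := abs_sub_le (v t).1 q.1 (v u).1
    have h5 := abs_sub_le (v t).2 q.2 (v u).2
    rw [abs_sub_comm _ q.1] at h4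
    rw [abs_sub_comm _ q.2] at h5
    push_cast at h1 h2
    have h6 := min_le_right ((n - t : ℕ) : ℤ) (s t)
    have h7 := min_le_right ((n - u : ℕ) : ℤ) (s u)
    linarith
  rw [Finset.card_biUnion]
  · exact Finset.sum_le_sum fun t _ => two_mul_sq_le_card_diamond _ _
  · intro t ht u hu htu
    rw [Finset.mem_coe, Finset.mem_Ico] at ht hu
    rcases lt_or_gt_of_ne htu with h | h
    · exact hdis t u ht.1 h
    · exact (hdis u t hu.1 h).symm

/-- The frame between the squares of half-widths `f ((k - 1) ^ 4) + M * k ^ 4` and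
`f (k ^ 4) - M * k ^ 4` has room for `(k + 1) ^ 4 - k ^ 4` disjoint diamonds of radius `r`. -/
def FrameHasRoom (f : ℕ → ℕ) (M k r : ℕ) : Prop :=
  (4 * k ^ 3 + 6 * k ^ 2 + 4 * k + 1) * (2 * r ^ 2 + 2 * r + 1) +
    (2 * (f ((k - 1) ^ 4) + M * k ^ 4) + 1) ^ 2 ≤ (2 * (f (k ^ 4) - M * k ^ 4) + 1) ^ 2

lemma FrameHasRoom.exists_separated {f : ℕ → ℕ} {M k r : ℕ} (h : FrameHasRoom f M k r) :
    ∃ e : ℕ → ℤ × ℤ, ∀ i < 4 * k ^ 3 + 6 * k ^ 2 + 4 * k + 1,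
      (e i ∈ box (f (k ^ 4) - M * k ^ 4) ∧ e i ∉ box (f ((k - 1) ^ 4) + M * k ^ 4)) ∧
      ∀ j < 4 * k ^ 3 + 6 * k ^ 2 + 4 * k + 1,
        |(e i).1 - (e j).1| + |(e i).2 - (e j).2| ≤ 2 * r → i = j := by
  have hA := Finset.le_card_sdiff (box (f ((k - 1) ^ 4) + M * k ^ 4))
    (box (f (k ^ 4) - M * k ^ 4))
  rw [card_box, card_box] at hA
  obtain ⟨e, he⟩ := _root_.exists_separated _ r _ ((Nat.le_sub_of_add_le h).trans hA)
  exact ⟨e, fun i hi => ⟨Finset.mem_sdiff.1 (he i hi).1, (he i hi).2⟩⟩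

section ThreeHalves

variable {c : ℝ} {f : ℕ → ℕ}

lemma monotone_of_eq_ceil (hc : 0 < c) (hf : ∀ n, f n = ⌈c * (n : ℝ) ^ ((3 : ℝ) / 2)⌉₊) :
    Monotone f := by
  intro a b hab
  rw [hf, hf]
  gcongr

lemma pow_four_bounds (hc : 0 < c) (hf : ∀ n, f n = ⌈c * (n : ℝ) ^ ((3 : ℝ) / 2)⌉₊) (k : ℕ) :
    c * (k : ℝ) ^ 6 ≤ f (k ^ 4) ∧ (f (k ^ 4) : ℝ) ≤ c * (k : ℝ) ^ 6 + 1 := by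
  have h : ((k ^ 4 : ℕ) : ℝ) ^ ((3 : ℝ) / 2) = (k : ℝ) ^ 6 := by
    rw [Nat.cast_pow, ← Real.rpow_natCast, ← Real.rpow_natCast, ← Real.rpow_mul (by positivity)]
    norm_num
  rw [hf, h]
  exact ⟨Nat.le_ceil _, (Nat.ceil_lt_add_one (by positivity)).le⟩

lemma eventually_frameHasRoom (hc : 0 < c) (hf : ∀ n, f n = ⌈c * (n : ℝ) ^ ((3 : ℝ) / 2)⌉₊)
    (M : ℕ) {b : ℝ} (hb0 : 0 ≤ b) (hb : b < Real.sqrt 6 * c) :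
    ∀ᶠ k : ℕ in atTop, M * k ^ 4 ≤ f (k ^ 4) ∧
      ∀ r : ℕ, (r : ℝ) ≤ b * (k + 1) ^ 4 + 1 → FrameHasRoom f M k r := by
  have hb2 : b ^ 2 < 6 * c ^ 2 := by
    calc b ^ 2 < (Real.sqrt 6 * c) ^ 2 := by gcongr
      _ = 6 * c ^ 2 := by rw [mul_pow, Real.sq_sqrt (by norm_num)]
  let g : ℝ → ℝ := fun x =>
    (2 * c * (6 - 15 * x + 20 * x ^ 2 - 15 * x ^ 3 + 6 * x ^ 4 - x ^ 5) - 4 * M * x - 2 * x ^ 5) *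
      (2 * c + 2 * c * (1 - x) ^ 6 + 4 * x ^ 6) -
    (4 + 6 * x + 4 * x ^ 2 + x ^ 3) *
      (2 * (b * (1 + x) ^ 4 + x ^ 4) ^ 2 + 2 * (b * (1 + x) ^ 4 + x ^ 4) * x ^ 4 + x ^ 8)
  have hg : Continuous g := by fun_prop
  have hg0 : 0 < g 0 := by
    simp only [g]
    norm_num
    nlinarith
  have hx := (hg.tendsto 0).comp (tendsto_one_div_atTop_nhds_zero_nat (𝕜 := ℝ))
  filter_upwards [hx.eventually (lt_mem_nhds hg0), eventually_ge_atTop 1,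
    eventually_ge_atTop ⌈M / c⌉₊] with k hk hk1 hkM
  have hk1' : (1 : ℝ) ≤ k := by exact_mod_cast hk1
  have hk0 : (0 : ℝ) < k := by linarith
  obtain ⟨hf1, hf2⟩ := pow_four_bounds hc hf k
  obtain ⟨-, hf3⟩ := pow_four_bounds hc hf (k - 1)
  rw [Nat.cast_sub hk1, Nat.cast_one] at hf3
  have hM : (M : ℝ) * k ^ 4 ≤ c * k ^ 6 := by
    have h1 : (M : ℝ) / c ≤ k := (Nat.le_ceil _).trans (by exact_mod_cast hkM)
    rw [div_le_iff₀ hc] at h1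
    calc (M : ℝ) * k ^ 4 ≤ (k * c) * k ^ 4 := by gcongr
      _ = c * k ^ 5 := by ring
      _ ≤ c * k ^ 6 := by gcongr; norm_num
  have hMf : M * k ^ 4 ≤ f (k ^ 4) := by exact_mod_cast hM.trans hf1
  refine ⟨hMf, fun r hr => ?_⟩
  have hpoly : (4 * (k : ℝ) ^ 3 + 6 * k ^ 2 + 4 * k + 1) *
      (2 * (b * (k + 1) ^ 4 + 1) ^ 2 + 2 * (b * (k + 1) ^ 4 + 1) + 1) +
      (2 * (c * (k - 1) ^ 6 + 1 + M * k ^ 4) + 1) ^ 2 ≤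
      (2 * (c * k ^ 6 - M * k ^ 4) + 1) ^ 2 := by
    have h1 : 0 < (k : ℝ) ^ 11 * g (1 / k) := mul_pos (by positivity) hk
    have h2 : (k : ℝ) ^ 11 * g (1 / k) = (2 * (c * k ^ 6 - M * k ^ 4) + 1) ^ 2 -
        ((4 * (k : ℝ) ^ 3 + 6 * k ^ 2 + 4 * k + 1) *
        (2 * (b * (k + 1) ^ 4 + 1) ^ 2 + 2 * (b * (k + 1) ^ 4 + 1) + 1) +
        (2 * (c * (k - 1) ^ 6 + 1 + M * k ^ 4) + 1) ^ 2) := by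
      simp only [g]
      field_simp
      ring
    linarith
  have hreal : (4 * (k : ℝ) ^ 3 + 6 * k ^ 2 + 4 * k + 1) * (2 * (r : ℝ) ^ 2 + 2 * r + 1) +
      (2 * ((f ((k - 1) ^ 4) : ℝ) + M * k ^ 4) + 1) ^ 2 ≤
      (2 * ((f (k ^ 4) : ℝ) - M * k ^ 4) + 1) ^ 2 := by
    refine le_trans ?_ (hpoly.trans ?_)
    · gcongr
    · have : 0 ≤ c * (k : ℝ) ^ 6 - M * k ^ 4 := by linarith
      gcongr
  unfold FrameHasRoom
  have := Nat.cast_sub (R := ℝ) hMf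
  push_cast at this
  rw [← this] at hreal
  exact_mod_cast hreal

/-- In the grids of half-width `⌈c n ^ (3 / 2)⌉` one can place, at every large time `t`, the centre
of a diamond of radius asymptotic to `√6 c t`, with all these diamonds disjoint. -/
lemma exists_packing (hc : 0 < c) (hf : ∀ n, f n = ⌈c * (n : ℝ) ^ ((3 : ℝ) / 2)⌉₊) :
    ∃ (v : ℕ → ℤ × ℤ) (s : ℕ → ℕ) (t₀ : ℕ), 1 ≤ t₀ ∧
      (∀ t, t₀ ≤ t → |(v t).1| + s t ≤ f t ∧ |(v t).2| + s t ≤ f t) ∧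
      (∀ t u, t₀ ≤ t → t < u → (s t + s u : ℤ) < |(v t).1 - (v u).1| + |(v t).2 - (v u).2|) ∧
      ∀ b, 0 ≤ b → b < Real.sqrt 6 * c → ∀ᶠ t in atTop, b * t ≤ s t := by
  classical
  have hmono := monotone_of_eq_ceil hc hf
  have hβ : 0 < Real.sqrt 6 * c := by positivity
  obtain ⟨M, hM⟩ := exists_nat_ge (16 * (Real.sqrt 6 * c) + 1)
  let R : ℕ → ℕ := fun k => Nat.findGreatest (FrameHasRoom f M k) (M * k ^ 4)
  have hRM (k : ℕ) : R k ≤ M * k ^ 4 := Nat.findGreatest_le _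
  have hR : ∀ b, 0 ≤ b → b < Real.sqrt 6 * c → ∀ᶠ k : ℕ in atTop, b * (k + 1) ^ 4 ≤ R k := by
    intro b hb0 hb
    filter_upwards [eventually_frameHasRoom hc hf M hb0 hb, eventually_ge_atTop 1] with k hk hk1
    have hk1' : (1 : ℝ) ≤ k := by exact_mod_cast hk1
    have hceil := Nat.ceil_lt_add_one (a := b * (k + 1) ^ 4) (by positivity)
    refine (Nat.le_ceil _).trans (Nat.cast_le.2 (Nat.le_findGreatest ?_ (hk.2 _ hceil.le)))
    have h1 : b * ((k : ℝ) + 1) ^ 4 + 1 ≤ M * k ^ 4 := by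
      calc b * ((k : ℝ) + 1) ^ 4 + 1 ≤ Real.sqrt 6 * c * (k + k) ^ 4 + 1 * k ^ 4 := by
            have : (1 : ℝ) ≤ (k : ℝ) ^ 4 := one_le_pow₀ hk1'
            gcongr
            linarith
        _ = (16 * (Real.sqrt 6 * c) + 1) * k ^ 4 := by ring
        _ ≤ M * k ^ 4 := by gcongr
    exact_mod_cast hceil.le.trans h1
  obtain ⟨k₀, hk₀⟩ := eventually_atTop.1
    ((eventually_frameHasRoom hc hf M le_rfl hβ).and (eventually_ge_atTop 1))
  have hroom (k : ℕ) (hk : k₀ ≤ k) : FrameHasRoom f M k (R k) :=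
    Nat.findGreatest_spec (Nat.zero_le _) ((hk₀ k hk).1.2 0 (by simp))
  choose! e he using fun k hk => (hroom k hk).exists_separated
  let K : ℕ → ℕ := fun t => t.sqrt.sqrt
  have hK1 (t : ℕ) : K t ^ 4 ≤ t := by
    calc K t ^ 4 = (K t ^ 2) ^ 2 := by ring
      _ ≤ t.sqrt ^ 2 := by gcongr; exact Nat.sqrt_le' _
      _ ≤ t := Nat.sqrt_le' _
  have hK2 (t : ℕ) : t < (K t + 1) ^ 4 := by
    calc t < (t.sqrt + 1) ^ 2 := Nat.lt_succ_sqrt' t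
      _ ≤ ((K t + 1) ^ 2) ^ 2 := by gcongr; exact Nat.lt_succ_sqrt' t.sqrt
      _ = (K t + 1) ^ 4 := by ring
  have hK3 (t k : ℕ) (h : k ^ 4 ≤ t) : k ≤ K t := by
    have := lt_of_pow_lt_pow_left₀ 4 (by positivity) (h.trans_lt (hK2 t))
    omega
  have hKmono {t u : ℕ} (h : t ≤ u) : K t ≤ K u := hK3 _ _ ((hK1 t).trans h)
  have hidx (t : ℕ) : t - K t ^ 4 < 4 * K t ^ 3 + 6 * K t ^ 2 + 4 * K t + 1 := by
    have h1 := hK2 t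
    have h2 : (K t + 1) ^ 4 = K t ^ 4 + (4 * K t ^ 3 + 6 * K t ^ 2 + 4 * K t + 1) := by ring
    have := hK1 t
    omega
  have hin (t : ℕ) (ht : k₀ ^ 4 ≤ t) := he (K t) (hK3 _ _ ht) _ (hidx t)
  refine ⟨fun t => e (K t) (t - K t ^ 4), fun t => R (K t), k₀ ^ 4,
    Nat.one_le_pow _ _ (hk₀ k₀ le_rfl).2, fun t ht => ?_, fun t u ht htu => ?_,
    fun b hb0 hb => ?_⟩
  · have h1 := mem_box.1 (hin t ht).1.1
    have h2 := hmono (hK1 t)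
    have h3 := hRM (K t)
    have h4 := (hk₀ _ (hK3 _ _ ht)).1.1
    beta_reduce
    constructor <;> omega
  · beta_reduce
    have h1 := hin t ht
    have h2 := hin u (ht.trans htu.le)
    rcases (hKmono htu.le).eq_or_lt with h | h
    · by_contra! hle
      rw [← h] at hle h2
      have h3 := h1.2 (u - K t ^ 4) (by rw [h]; exact hidx u) (by linarith)
      have h4 := hK1 t
      have h5 := hK1 u
      rw [← h] at h5
      omega
    · have hb1 := mem_box.1 h1.1.1
      have hb2 := h2.1.2
      rw [mem_box] at hb2
      have h3 : f (K t ^ 4) ≤ f ((K u - 1) ^ 4) :=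
        hmono (Nat.pow_le_pow_left (by omega) 4)
      have h4 := hRM (K t)
      have h5 := hRM (K u)
      have h6 := (hk₀ _ (hK3 _ _ ht)).1.1
      have e1 := abs_sub_abs_le_abs_sub (e (K u) (u - K u ^ 4)).1 (e (K t) (t - K t ^ 4)).1
      have e2 := abs_sub_abs_le_abs_sub (e (K u) (u - K u ^ 4)).2 (e (K t) (t - K t ^ 4)).2
      rw [abs_sub_comm] at e1 e2
      have e3 := abs_nonneg ((e (K t) (t - K t ^ 4)).1 - (e (K u) (u - K u ^ 4)).1)
      have e4 := abs_nonneg ((e (K t) (t - K t ^ 4)).2 - (e (K u) (u - K u ^ 4)).2)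
      omega
  · have hKtop : Tendsto K atTop atTop :=
      tendsto_atTop.2 fun k => by
        filter_upwards [eventually_ge_atTop (k ^ 4)] with t ht using hK3 _ _ ht
    filter_upwards [hKtop.eventually (hR b hb0 hb)] with t ht
    refine le_trans ?_ ht
    gcongr
    exact_mod_cast (hK2 t).le

end ThreeHalves

lemma sum_range_sq (N : ℕ) :
    ∑ j ∈ Finset.range N, (j : ℝ) ^ 2 = (N : ℝ) ^ 3 / 3 - (N : ℝ) ^ 2 / 2 + N / 6 := by
  induction N with
  | zero => simp
  | succ N ih => rw [Finset.sum_range_succ, ih]; push_cast; ring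

lemma sum_range_diamond (N : ℕ) :
    ∑ j ∈ Finset.range N, (2 * (j : ℝ) ^ 2 + 2 * j + 1) = (2 * (N : ℝ) ^ 3 + N) / 3 := by
  induction N with
  | zero => simp
  | succ N ih => rw [Finset.sum_range_succ, ih]; push_cast; ring

section Radii

variable {β θ : ℝ} {s : ℕ → ℕ} {t₁ m n : ℕ}

/-- The total area of the diamonds of radius `min (n - t) (s t)`, bounded below by splitting the
times `t` at `m = ⌊n / (1 + β)⌋`. -/
lemma le_sum_min_sq (hβ : 0 < β) (hθ0 : 0 ≤ θ) (hθ1 : θ ≤ 1)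
    (hs : ∀ t, t₁ ≤ t → θ * β * t ≤ s t) (hm : m = ⌊(1 + β)⁻¹ * n⌋₊) (hmn : m ≤ n)
    (htm : t₁ ≤ m + 1) :
    2 * θ ^ 2 * (β ^ 2 * ∑ t ∈ Finset.Ico t₁ (m + 1), (t : ℝ) ^ 2 +
      ∑ j ∈ Finset.range (n - m), (j : ℝ) ^ 2) ≤
      ∑ t ∈ Finset.Ico t₁ (n + 1), 2 * ((min (n - t) (s t) : ℕ) : ℝ) ^ 2 := by
  have hκ : 0 < 1 + β := by linarith
  have hn0 : (0 : ℝ) ≤ n := by positivity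
  rw [← Finset.sum_Ico_consecutive _ htm (by omega : m + 1 ≤ n + 1), mul_add]
  refine add_le_add ?_ ?_
  · rw [Finset.mul_sum, Finset.mul_sum]
    refine Finset.sum_le_sum fun t ht => ?_
    rw [Finset.mem_Ico] at ht
    have h1 : (t : ℝ) ≤ (1 + β)⁻¹ * n :=
      (Nat.cast_le.2 (by omega : t ≤ m)).trans (hm ▸ Nat.floor_le (by positivity))
    rw [inv_mul_eq_div, le_div_iff₀ hκ] at h1
    have h2 : θ * β * t ≤ (min (n - t) (s t) : ℕ) := by
      rw [Nat.cast_min, Nat.cast_sub (by omega)]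
      refine le_min ?_ (hs t ht.1)
      have : θ * (β * t) ≤ 1 * (β * t) := by gcongr
      linarith
    calc 2 * θ ^ 2 * (β ^ 2 * (t : ℝ) ^ 2) = 2 * (θ * β * t) ^ 2 := by ring
      _ ≤ _ := by gcongr
  · have hrefl := Finset.sum_Ico_reflect (fun j => (j : ℝ) ^ 2) (m + 1) (le_refl (n + 1))
    rw [Nat.sub_self, Nat.add_sub_add_right, Nat.Ico_zero_eq_range] at hrefl
    rw [← hrefl, Finset.mul_sum]
    refine Finset.sum_le_sum fun t ht => ?_
    rw [Finset.mem_Ico] at ht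
    have h1 : (1 + β)⁻¹ * n ≤ (t : ℝ) := by
      refine (Nat.lt_floor_add_one _).le.trans ?_
      rw [← hm]
      exact_mod_cast ht.1
    rw [inv_mul_eq_div, div_le_iff₀ hκ] at h1
    have h0 : (0 : ℝ) ≤ (n - t : ℕ) := by positivity
    have h2 : θ * (n - t : ℕ) ≤ (min (n - t) (s t) : ℕ) := by
      rw [Nat.cast_min]
      refine le_min (mul_le_of_le_one_left h0 hθ1) (le_trans ?_ (hs t (by omega)))
      rw [Nat.cast_sub (by omega), mul_assoc]
      gcongr
      linarith
    calc 2 * θ ^ 2 * ((n - t : ℕ) : ℝ) ^ 2 = 2 * (θ * (n - t : ℕ)) ^ 2 := by ring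
      _ ≤ _ := by gcongr

end Radii

section ThreeHalves

variable {c : ℝ} {f : ℕ → ℕ}

lemma three_halves_bounds (hc : 0 < c) (hf : ∀ n, f n = ⌈c * (n : ℝ) ^ ((3 : ℝ) / 2)⌉₊) (n : ℕ) :
    c * (n * √n) ≤ f n ∧ (f n : ℝ) ≤ c * (n * √n) + 1 := by
  have h : (n : ℝ) ^ ((3 : ℝ) / 2) = n * √n := by
    rw [Real.sqrt_eq_rpow, ← Real.rpow_one_add' (by positivity) (by norm_num)]
    norm_num
  rw [hf, h]
  exact ⟨Nat.le_ceil _, (Nat.ceil_lt_add_one (by positivity)).le⟩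

lemma tendsto_inv_sqrt_nat : Tendsto (fun n : ℕ => (√n)⁻¹) atTop (nhds 0) :=
  tendsto_inv_atTop_zero.comp (Real.tendsto_sqrt_atTop.comp tendsto_natCast_atTop_atTop)

lemma tendsto_grid_card_div (hc : 0 < c)
    (hf : ∀ n, f n = ⌈c * (n : ℝ) ^ ((3 : ℝ) / 2)⌉₊) :
    Tendsto (fun n => (2 * (f n : ℝ) + 1) ^ 2 / (n : ℝ) ^ 3) atTop (nhds (4 * c ^ 2)) := by
  have hlim (a : ℝ) :
      Tendsto (fun n : ℕ => (2 * c + a * ((√n)⁻¹) ^ 3) ^ 2) atTop (nhds (4 * c ^ 2)) := by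
    have hcont : Continuous fun z : ℝ => (2 * c + a * z ^ 3) ^ 2 := by fun_prop
    have h0 : (2 * c + a * 0 ^ 3) ^ 2 = 4 * c ^ 2 := by ring
    exact h0 ▸ (hcont.tendsto 0).comp tendsto_inv_sqrt_nat
  have heq (a : ℝ) (n : ℕ) (hn : 1 ≤ n) : (2 * c + a * ((√n)⁻¹) ^ 3) ^ 2 =
      (2 * (c * (n * √n)) + a) ^ 2 / (n : ℝ) ^ 3 := by
    have hn0 : (0 : ℝ) < n := by exact_mod_cast hn
    have hz : 0 < √(n : ℝ) := Real.sqrt_pos.2 hn0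
    have hsq : (n : ℝ) = √n ^ 2 := (Real.sq_sqrt hn0.le).symm
    generalize √(n : ℝ) = z at *
    rw [hsq]
    field_simp
  refine tendsto_of_tendsto_of_tendsto_of_le_of_le' (hlim 1) (hlim 3) ?_ ?_
  all_goals
    filter_upwards [eventually_ge_atTop 1] with n hn
    rw [heq _ n hn]
    obtain ⟨h1, h2⟩ := three_halves_bounds hc hf n
    gcongr ?_ ^ 2 / _
    linarith

variable {V : ℕ → Option (ℤ × ℤ)}

lemma floor_inv_mul_le {β : ℝ} (hβ : 0 < β) (n : ℕ) : ⌊(1 + β)⁻¹ * n⌋₊ ≤ n := by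
  refine Nat.floor_le_of_le (mul_le_of_le_one_left (by positivity) (inv_le_one_of_one_le₀ ?_))
  linarith

lemma optimal_split (hc : 0 < c) : 2 / 3 * ((Real.sqrt 6 * c) ^ 2 * ((1 + Real.sqrt 6 * c)⁻¹) ^ 3 +
    (1 - (1 + Real.sqrt 6 * c)⁻¹) ^ 3) = 4 * c ^ 2 * ((1 + Real.sqrt 6 * c) ^ 2)⁻¹ := by
  have hβ2 : (Real.sqrt 6 * c) ^ 2 = 6 * c ^ 2 := by rw [mul_pow, Real.sq_sqrt (by norm_num)]
  have hβ : 0 < Real.sqrt 6 * c := by positivity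
  have hc2 : c ^ 2 = (Real.sqrt 6 * c) ^ 2 / 6 := by rw [hβ2]; ring
  rw [hc2]
  generalize Real.sqrt 6 * c = β at *
  field_simp
  ring

/-- No activator sequence has upper burning density greater than `(1 + √6 c)⁻²`. -/
lemma exists_upper_bound (hc : 0 < c) (hf : ∀ n, f n = ⌈c * (n : ℝ) ^ ((3 : ℝ) / 2)⌉₊)
    (hV : IsActivator f V) :
    ∃ U : ℕ → ℝ, Tendsto U atTop (nhds (4 * c ^ 2 * ((1 + Real.sqrt 6 * c) ^ 2)⁻¹)) ∧
      ∀ᶠ n : ℕ in atTop, ((burnSet f V n).card : ℝ) / (n : ℝ) ^ 3 ≤ U n := by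
  have hβ : 0 < Real.sqrt 6 * c := by positivity
  have hopt := optimal_split hc
  have hβ2 : (Real.sqrt 6 * c) ^ 2 = 6 * c ^ 2 := by rw [mul_pow, Real.sq_sqrt (by norm_num)]
  generalize Real.sqrt 6 * c = β at *
  obtain ⟨κ, hκ⟩ : ∃ κ, κ = (1 + β)⁻¹ := ⟨_, rfl⟩
  have hκ0 : 0 < κ := by rw [hκ]; positivity
  let m : ℕ → ℕ := fun n => ⌊κ * n⌋₊
  have hmlim : Tendsto (fun n : ℕ => (m n : ℝ) / n) atTop (nhds κ) :=
    (tendsto_nat_floor_mul_div_atTop hκ0.le).comp tendsto_natCast_atTop_atTop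
  let G : ℝ × ℝ → ℝ := fun p => (2 * (c * (κ * √κ)) + 3 * p.2 ^ 3 + 2 * p.2) ^ 2 +
    (2 * (1 - p.1) ^ 3 + (1 - p.1) * p.2 ^ 4) / 3
  have hG : Continuous G := by fun_prop
  have hlim := (hG.tendsto (κ, 0)).comp (hmlim.prodMk_nhds tendsto_inv_sqrt_nat)
  have hG0 : G (κ, 0) = 4 * c ^ 2 * ((1 + β) ^ 2)⁻¹ := by
    have hκκ : √κ ^ 2 = κ := Real.sq_sqrt hκ0.le
    rw [← hopt, ← hκ, hβ2]
    simp only [G]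
    linear_combination (4 * c ^ 2 * κ ^ 2) * hκκ
  rw [hG0] at hlim
  refine ⟨_, hlim, ?_⟩
  filter_upwards [eventually_ge_atTop 1] with n hn
  have hn0 : (0 : ℝ) < n := by exact_mod_cast hn
  have hmn : m n ≤ n := by
    simp only [m, hκ]
    exact floor_inv_mul_le hβ n
  have h1 : ((burnSet f V n).card : ℝ) ≤ (2 * ((f (m n) : ℝ) + n) + 1) ^ 2 +
      (2 * (n - m n : ℝ) ^ 3 + (n - m n)) / 3 := by
    have := card_burnSet_le (monotone_of_eq_ceil hc hf) hV hmn
    rw [← Nat.cast_sub hmn, ← sum_range_diamond]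
    exact_mod_cast this
  have hfm : (f (m n) : ℝ) ≤ c * (κ * √κ * (n * √n)) + 1 := by
    have hm : (m n : ℝ) ≤ κ * n := Nat.floor_le (by positivity)
    calc (f (m n) : ℝ) ≤ c * (m n * √(m n)) + 1 := (three_halves_bounds hc hf _).2
      _ ≤ c * ((κ * n) * √(κ * n)) + 1 := by gcongr
      _ = c * (κ * √κ * (n * √n)) + 1 := by rw [Real.sqrt_mul hκ0.le]; ring
  have h2 : ((burnSet f V n).card : ℝ) ≤ (2 * (c * (κ * √κ * (n * √n)) + 1 + n) + 1) ^ 2 +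
      (2 * (n - m n : ℝ) ^ 3 + (n - m n)) / 3 := h1.trans (by gcongr)
  rw [div_le_iff₀ (by positivity)]
  refine h2.trans_eq ?_
  simp only [G, Function.comp]
  have hz : 0 < √(n : ℝ) := Real.sqrt_pos.2 hn0
  have hsq : (n : ℝ) = √n ^ 2 := (Real.sq_sqrt hn0.le).symm
  generalize (m n : ℝ) = y at *
  generalize √(n : ℝ) = z at *
  rw [hsq]
  field_simp
  ring

/-- Disjoint diamonds of radius asymptotic to `√6 c t` give a density of at least
`θ ^ 2 (1 + √6 c)⁻²`, for every `θ < 1`. -/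
lemma exists_lower_bound (hc : 0 < c) {s : ℕ → ℕ} {t₀ : ℕ}
    (hcard : ∀ n, ∑ t ∈ Finset.Ico t₀ (n + 1), 2 * (min (n - t) (s t)) ^ 2 ≤ (burnSet f V n).card)
    (hs : ∀ b, 0 ≤ b → b < Real.sqrt 6 * c → ∀ᶠ t in atTop, b * t ≤ s t)
    {θ : ℝ} (hθ0 : 0 ≤ θ) (hθ1 : θ < 1) :
    ∃ L : ℕ → ℝ, Tendsto L atTop (nhds (θ ^ 2 * (4 * c ^ 2 * ((1 + Real.sqrt 6 * c) ^ 2)⁻¹))) ∧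
      ∀ᶠ n : ℕ in atTop, L n ≤ ((burnSet f V n).card : ℝ) / (n : ℝ) ^ 3 := by
  have hβ : 0 < Real.sqrt 6 * c := by positivity
  have hopt := optimal_split hc
  generalize Real.sqrt 6 * c = β at *
  obtain ⟨t₁, ht₁⟩ := eventually_atTop.1 ((hs (θ * β) (by positivity)
    (mul_lt_of_lt_one_left hβ hθ1)).and (eventually_ge_atTop t₀))
  obtain ⟨κ, hκ⟩ : ∃ κ, κ = (1 + β)⁻¹ := ⟨_, rfl⟩
  have hκ0 : 0 < κ := by rw [hκ]; positivity
  let m : ℕ → ℕ := fun n => ⌊κ * n⌋₊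
  have hmlim : Tendsto (fun n : ℕ => (m n : ℝ) / n) atTop (nhds κ) :=
    (tendsto_nat_floor_mul_div_atTop hκ0.le).comp tendsto_natCast_atTop_atTop
  have hmtop : Tendsto m atTop atTop :=
    tendsto_nat_floor_atTop.comp (tendsto_natCast_atTop_atTop.const_mul_atTop hκ0)
  let C : ℝ := ∑ t ∈ Finset.range t₁, (t : ℝ) ^ 2
  let G : ℝ × ℝ → ℝ := fun p => 2 * θ ^ 2 *
    (β ^ 2 * ((p.1 + p.2) ^ 3 / 3 - (p.1 + p.2) ^ 2 * p.2 / 2 - C * p.2 ^ 3) +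
      ((1 - p.1) ^ 3 / 3 - (1 - p.1) ^ 2 * p.2 / 2))
  have hG : Continuous G := by fun_prop
  have hlim := (hG.tendsto (κ, 0)).comp
    (hmlim.prodMk_nhds (tendsto_one_div_atTop_nhds_zero_nat (𝕜 := ℝ)))
  have hG0 : G (κ, 0) = θ ^ 2 * (4 * c ^ 2 * ((1 + β) ^ 2)⁻¹) := by
    rw [← hopt, ← hκ]
    simp only [G]
    ring
  rw [hG0] at hlim
  refine ⟨_, hlim, ?_⟩
  filter_upwards [eventually_ge_atTop 1, hmtop.eventually_ge_atTop t₁] with n hn hmt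
  have hn0 : (0 : ℝ) < n := by exact_mod_cast hn
  have hmn : m n ≤ n := by
    simp only [m, hκ]
    exact floor_inv_mul_le hβ n
  have h1 : (∑ t ∈ Finset.Ico t₁ (n + 1), 2 * ((min (n - t) (s t) : ℕ) : ℝ) ^ 2) ≤
      ((burnSet f V n).card : ℝ) := by
    have : ∑ t ∈ Finset.Ico t₁ (n + 1), 2 * (min (n - t) (s t)) ^ 2 ≤
        (burnSet f V n).card := by
      refine le_trans (Finset.sum_le_sum_of_subset ?_) (hcard n)
      exact Finset.Ico_subset_Ico_left (ht₁ t₁ le_rfl).2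
    exact_mod_cast this
  have h2 := (le_sum_min_sq hβ hθ0 hθ1.le (fun t ht => (ht₁ t ht).1)
    (by simp only [m, hκ]) hmn (by omega : t₁ ≤ m n + 1)).trans h1
  rw [Finset.sum_Ico_eq_sub _ (by omega : t₁ ≤ m n + 1), sum_range_sq (m n + 1),
    sum_range_sq (n - m n), Nat.cast_sub hmn] at h2
  rw [le_div_iff₀ (by positivity)]
  refine le_trans ?_ h2
  have h3 : G ((m n : ℝ) / n, 1 / n) * (n : ℝ) ^ 3 = 2 * θ ^ 2 *
      (β ^ 2 * (((m n + 1 : ℕ) : ℝ) ^ 3 / 3 - ((m n + 1 : ℕ) : ℝ) ^ 2 / 2 - C) +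
        ((n - m n : ℝ) ^ 3 / 3 - (n - m n : ℝ) ^ 2 / 2)) := by
    simp only [G]
    push_cast
    field_simp
  have h4 : (0 : ℝ) ≤ n - m n := sub_nonneg.2 (Nat.cast_le.2 hmn)
  have h5 : (0 : ℝ) ≤ (m n + 1 : ℕ) := by positivity
  refine h3.trans_le ?_
  gcongr
  all_goals linarith

end ThreeHalves

/-- for `f(n) = ⌈c n^(3/2)⌉` with `c > 0`, there is a non-empty activator
sequence with burning density exactly `(1 + √6 c)⁻²`. -/
theorem three_halves_lower_bound (c : ℝ) (hc : 0 < c) (f : ℕ → ℕ)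
    (hf : ∀ n, f n = ⌈c * (n : ℝ) ^ ((3 : ℝ) / 2)⌉₊) :
    ∃ V : ℕ → Option (ℤ × ℤ), IsActivator f V ∧ (∃ t, 1 ≤ t ∧ V t ≠ none) ∧
      HasBurningDensity f V (((1 + Real.sqrt 6 * c) ^ 2)⁻¹) := by
  obtain ⟨v, s, t₀, ht₀, hg, hsep, hs⟩ := exists_packing hc hf
  have hmono := monotone_of_eq_ceil hc hf
  let V : ℕ → Option (ℤ × ℤ) := fun t => if t₀ ≤ t then some (v t) else none
  have hVv (t : ℕ) (ht : t₀ ≤ t) : V t = some (v t) := if_pos ht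
  have hVact : IsActivator f V := by
    intro n _ p hp
    by_cases ht : t₀ ≤ n
    · rw [hVv n ht, Option.some.injEq] at hp
      obtain ⟨h1, h2⟩ := hg n ht
      rw [← hp]
      constructor <;> omega
    · simp [V, ht] at hp
  refine ⟨V, hVact, ⟨t₀, ht₀, by simp [hVv]⟩, ?_⟩
  have hw := tendsto_grid_card_div hc hf
  have hc0 : 4 * c ^ 2 ≠ 0 := by positivity
  have heq : ∀ᶠ n : ℕ in atTop, densitySeq f V n = ((burnSet f V n).card : ℝ) / (n : ℝ) ^ 3 /
      ((2 * (f n : ℝ) + 1) ^ 2 / (n : ℝ) ^ 3) := by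
    filter_upwards [eventually_ge_atTop 1] with n hn
    have hn0 : (0 : ℝ) < n := by exact_mod_cast hn
    rw [densitySeq, div_div_div_cancel_right₀ (by positivity)]
  refine tendsto_order.2 ⟨fun a ha => ?_, fun a ha => ?_⟩
  · obtain ⟨θ, hθa, hθ0, hθ1⟩ : ∃ θ : ℝ, a < θ ^ 2 * ((1 + Real.sqrt 6 * c) ^ 2)⁻¹ ∧
        0 < θ ∧ θ < 1 := by
      have hcont : Continuous fun θ : ℝ => θ ^ 2 * ((1 + Real.sqrt 6 * c) ^ 2)⁻¹ := by fun_prop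
      have h1 := (hcont.tendsto 1).eventually_const_lt (u := a) (by simpa using ha)
      exact ((h1.filter_mono nhdsWithin_le_nhds).and
        (Ioo_mem_nhdsLT (zero_lt_one (α := ℝ)))).exists
    obtain ⟨L, hL, hLle⟩ := exists_lower_bound hc
      (le_card_burnSet hmono ht₀ hVv hg hsep) hs hθ0.le hθ1
    have h1 := hL.div hw hc0
    have h2 : θ ^ 2 * (4 * c ^ 2 * ((1 + Real.sqrt 6 * c) ^ 2)⁻¹) / (4 * c ^ 2) =
        θ ^ 2 * ((1 + Real.sqrt 6 * c) ^ 2)⁻¹ := by field_simp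
    rw [h2] at h1
    filter_upwards [heq, hLle, h1.eventually_const_lt hθa] with n e1 e2 e3
    rw [e1]
    refine e3.trans_le ?_
    simp only [Pi.div_apply]
    gcongr
  · obtain ⟨U, hU, hUle⟩ := exists_upper_bound hc hf hVact
    have h1 := hU.div hw hc0
    rw [mul_div_cancel_left₀ _ hc0] at h1
    filter_upwards [heq, hUle, h1.eventually_lt_const ha] with n e1 e2 e3
    rw [e1]
    refine lt_of_le_of_lt ?_ e3
    simp only [Pi.div_apply]
    gcongr
end
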